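/- Let p ∈ ℝ and let f : ℝ² × ℝ → ℝ be smooth with compact support contained in ℝ² × (0,∞). For every x ∈ ℝ² and y > 0: f(x, y) = −(1 / (4π²)) · ∫_{ℝ²} (|u − x|² + y²)^{(p−1)/2} · |u − x|^{-1} · (Δ_u R^(p) f)(u, arctan(|u − x| / y)) du, where Δ_u denotes the Laplacian of R^(p) f with respect to its first (two-dimensional) argument. -/

import Mathlib

open MeasureTheory Real Metric
open scoped RealInnerProductSpace

noncomputable section

/-- The arclength measure on the unit circle `S^1 ⊆ ℝ²`. -/
def circleMeasure : Measure (sphere (0 : EuclideanSpace ℝ (Fin 2)) 1) :=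
  (volume : Measure (EuclideanSpace ℝ (Fin 2))).toSphere

/-- The three-dimensional conical Radon transform with radial weight `1/s^p`:
`(R^(p) f)(u, θ) = ∫_0^∞ s^(-p) ∫_{S^1} f(u + s sin θ n, s cos θ) (s sin θ) dn ds`. -/
def coneRadon3 (p : ℝ) (f : EuclideanSpace ℝ (Fin 2) × ℝ → ℝ)
    (u : EuclideanSpace ℝ (Fin 2)) (θ : ℝ) : ℝ :=
  ∫ s in Set.Ioi (0 : ℝ),
    s ^ (-p) *
      ∫ n, f (u + (s * Real.sin θ) • (n : EuclideanSpace ℝ (Fin 2)), s * Real.cos θ) *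
          (s * Real.sin θ) ∂circleMeasure

/-- The Laplacian of a function on `ℝ²`, as the sum of the second partial derivatives. -/
def lap2 (h : EuclideanSpace ℝ (Fin 2) → ℝ) (u : EuclideanSpace ℝ (Fin 2)) : ℝ :=
  ∑ i : Fin 2,
    fderiv ℝ (fun v => fderiv ℝ h v (EuclideanSpace.single i (1 : ℝ))) u
      (EuclideanSpace.single i (1 : ℝ))

/-- The Euclidean plane. -/
abbrev Plane := EuclideanSpace ℝ (Fin 2)

lemma contDiff_fderiv_apply {V : Type*} [NormedAddCommGroup V] [NormedSpace ℝ V] {ψ : V → ℝ}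
    (h : ContDiff ℝ (⊤ : ℕ∞) ψ) (e : V) : ContDiff ℝ (⊤ : ℕ∞) fun v => fderiv ℝ ψ v e :=
  (h.fderiv_right (m := (⊤ : ℕ∞)) (by simp)).clm_apply contDiff_const

/-- Partial derivative in the `i`-th coordinate of the first argument. -/
def partialFst (i : Fin 2) (ψ : Plane × ℝ → ℝ) (q : Plane × ℝ) : ℝ :=
  fderiv ℝ ψ q (EuclideanSpace.single i (1 : ℝ), 0)

/-- Laplacian in the first argument. -/
def lapFst (ψ : Plane × ℝ → ℝ) (q : Plane × ℝ) : ℝ :=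
  ∑ i : Fin 2, partialFst i (partialFst i ψ) q

lemma contDiff_partialFst {ψ : Plane × ℝ → ℝ} (h : ContDiff ℝ (⊤ : ℕ∞) ψ) (i : Fin 2) :
    ContDiff ℝ (⊤ : ℕ∞) (partialFst i ψ) :=
  contDiff_fderiv_apply h _

lemma hasCompactSupport_partialFst {ψ : Plane × ℝ → ℝ} (h : HasCompactSupport ψ) (i : Fin 2) :
    HasCompactSupport (partialFst i ψ) :=
  h.fderiv_apply (𝕜 := ℝ) _

lemma contDiff_lapFst {ψ : Plane × ℝ → ℝ} (h : ContDiff ℝ (⊤ : ℕ∞) ψ) :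
    ContDiff ℝ (⊤ : ℕ∞) (lapFst ψ) :=
  ContDiff.sum fun i _ => contDiff_partialFst (contDiff_partialFst h i) i

lemma hasCompactSupport_lapFst {ψ : Plane × ℝ → ℝ} (h : HasCompactSupport ψ) :
    HasCompactSupport (lapFst ψ) := by
  have h2 : lapFst ψ = partialFst 0 (partialFst 0 ψ) + partialFst 1 (partialFst 1 ψ) := by
    ext q; simp [lapFst, Fin.sum_univ_two]
  rw [h2]
  exact (hasCompactSupport_partialFst (hasCompactSupport_partialFst h 0) 0).add
    (hasCompactSupport_partialFst (hasCompactSupport_partialFst h 1) 1)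

lemma fderiv_slice {ψ : Plane × ℝ → ℝ} (h : Differentiable ℝ ψ) (z : ℝ) (v : Plane) (i : Fin 2) :
    fderiv ℝ (fun v => ψ (v, z)) v (EuclideanSpace.single i (1 : ℝ)) = partialFst i ψ (v, z) := by
  have h1 : HasFDerivAt (fun v : Plane => (v, z)) (ContinuousLinearMap.inl ℝ Plane ℝ) v :=
    hasFDerivAt_prodMk_left v z
  have h2 := (h (v, z)).hasFDerivAt.comp v h1
  have h3 : fderiv ℝ (fun v => ψ (v, z)) v = _ := h2.fderiv
  rw [h3]
  simp [partialFst]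

lemma lap2_slice {ψ : Plane × ℝ → ℝ} (h : ContDiff ℝ (⊤ : ℕ∞) ψ) (z : ℝ) (v : Plane) :
    lap2 (fun v => ψ (v, z)) v = lapFst ψ (v, z) := by
  unfold lap2 lapFst
  refine Finset.sum_congr rfl fun i _ => ?_
  simp_rw [fderiv_slice (h.differentiable (by simp)) z _ i]
  exact fderiv_slice ((contDiff_partialFst h i).differentiable (by simp)) z v i

lemma hasCompactSupport_comp_graph {ψ : Plane × ℝ → ℝ} (h : HasCompactSupport ψ) (g : Plane → ℝ) :
    HasCompactSupport fun v => ψ (v, g v) :=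
  HasCompactSupport.intro (h.image continuous_fst) fun v hv => by
    by_contra hne
    exact hv ⟨(v, g v), subset_tsupport _ hne, rfl⟩

lemma integral_fderiv_eq_zero {φ : Plane → ℝ} (h : ContDiff ℝ 1 φ) (hc : HasCompactSupport φ)
    (e : Plane) : ∫ v, fderiv ℝ φ v e = 0 := by
  have hcont : Continuous fun v => fderiv ℝ φ v e :=
    (h.continuous_fderiv (by simp)).clm_apply continuous_const
  have hi : Integrable fun v => fderiv ℝ φ v e :=
    hcont.integrable_of_hasCompactSupport (hc.fderiv_apply (𝕜 := ℝ) e)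
  have := integral_mul_fderiv_eq_neg_fderiv_mul_of_integrable (μ := (volume : Measure Plane))
    (f := fun _ : Plane => (1 : ℝ)) (g := φ) (v := e) (by simp) (by simpa using hi)
    (by simpa using h.continuous.integrable_of_hasCompactSupport hc) (fun _ _ => by simp)
    (fun x _ => h.differentiable (by simp) x)
  simpa using this

lemma integral_lapFst_slice {ψ : Plane × ℝ → ℝ} (h : ContDiff ℝ (⊤ : ℕ∞) ψ)
    (hc : HasCompactSupport ψ) (z : ℝ) : ∫ v, lapFst ψ (v, z) = 0 := by
  have key : ∀ i, ContDiff ℝ 1 (fun v : Plane => partialFst i ψ (v, z)) := fun i =>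
    ((contDiff_partialFst h i).of_le (by exact_mod_cast le_top)).comp
      (contDiff_id.prodMk contDiff_const)
  have hz : ∀ i, HasCompactSupport fun v : Plane => partialFst i ψ (v, z) := fun i =>
    hasCompactSupport_comp_graph (hasCompactSupport_partialFst hc i) _
  unfold lapFst
  simp_rw [← fun i v => fderiv_slice ((contDiff_partialFst h i).differentiable (by simp)) z v i]
  rw [integral_finsetSum]
  · exact Finset.sum_eq_zero fun i _ => integral_fderiv_eq_zero (key i) (hz i) _
  · intro i _
    exact (((key i).continuous_fderiv (by simp)).clm_apply
      continuous_const).integrable_of_hasCompactSupport ((hz i).fderiv_apply (𝕜 := ℝ) _)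

/-- An integrable weight on the plane, of order `‖u‖⁻¹` at `0` and `‖u‖⁻³` at infinity. -/
def planeWeight (u : Plane) : ℝ := ‖u‖⁻¹ * (1 + ‖u‖ ^ 2)⁻¹

lemma planeWeight_nonneg (u : Plane) : 0 ≤ planeWeight u := by
  unfold planeWeight; positivity

lemma integrable_planeWeight : Integrable planeWeight := by
  have h := (integrable_fun_norm_addHaar (volume : Measure Plane)
    (f := fun r : ℝ => r⁻¹ * (1 + r ^ 2)⁻¹)).2 ?_
  · exact h
  · refine (integrable_inv_one_add_sq.integrableOn (s := Set.Ioi 0)).congr_fun (fun r hr => ?_)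
      measurableSet_Ioi
    have hr : r ≠ 0 := ne_of_gt hr
    simp
    field_simp

lemma inv_norm_le_planeWeight {M : ℝ} {v : Plane} (h : ‖v‖ ≤ M) :
    ‖v‖⁻¹ ≤ (1 + M ^ 2) * planeWeight v := by
  unfold planeWeight
  have h2 : ‖v‖ ^ 2 ≤ M ^ 2 := by gcongr
  have h3 : 1 ≤ (1 + M ^ 2) * (1 + ‖v‖ ^ 2)⁻¹ := by
    rw [← div_eq_mul_inv, one_le_div (by positivity)]; linarith
  calc ‖v‖⁻¹ = ‖v‖⁻¹ * 1 := by ring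
    _ ≤ ‖v‖⁻¹ * ((1 + M ^ 2) * (1 + ‖v‖ ^ 2)⁻¹) := by gcongr
    _ = _ := by ring

lemma inv_norm_pow_le_planeWeight {u : Plane} (h : 1 < ‖u‖) :
    (‖u‖ ^ 2)⁻¹ * ‖u‖⁻¹ ≤ 2 * planeWeight u := by
  unfold planeWeight
  have h3 : (‖u‖ ^ 2)⁻¹ ≤ 2 * (1 + ‖u‖ ^ 2)⁻¹ := by
    rw [← div_eq_mul_inv, le_div_iff₀ (by positivity), inv_mul_le_iff₀ (by positivity)]
    nlinarith
  calc _ ≤ 2 * (1 + ‖u‖ ^ 2)⁻¹ * ‖u‖⁻¹ := by gcongr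
    _ = _ := by ring

/-- The cone integrand with vertex direction `w`, with its value at height `y` cut off. -/
def coneKernel (H : Plane × ℝ → ℝ) (y : ℝ) (w u v : Plane) : ℝ :=
  (‖u‖ ^ 2)⁻¹ *
    (H (v, y * (‖w - u‖ / ‖u‖)) - {u : Plane | 1 < ‖u‖}.indicator (fun _ => H (v, y)) u)

lemma abs_coneKernel_le {H : Plane × ℝ → ℝ} {y M K C : ℝ} (hy : 0 < y) (hM : 0 < M) (hK0 : 0 ≤ K)
    (hC : 0 ≤ C)
    (hsupp : ∀ q, H q ≠ 0 → ‖q.1‖ ≤ M ∧ |q.2| ≤ M)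
    (hbd : ∀ q, |H q| ≤ C) (hlip : ∀ v z z', |H (v, z) - H (v, z')| ≤ C * |z - z'|)
    {w u v : Plane} (hu : u ≠ 0) (hv : v ≠ 0)
    (hw : ‖v‖ ≤ M → ‖v‖ ≤ K * ‖w‖ ∧ ‖w‖ ≤ K) :
    |coneKernel H y w u v| ≤
      (C * (K * (M / y + 1)) * 2 * (1 + M ^ 2) + C * (y * K) * 2 * (M * (1 + M ^ 2))) *
        (planeWeight u * planeWeight v) := by
  have hu0 : 0 < ‖u‖ := norm_pos_iff.2 hu
  have hv0 : 0 < ‖v‖ := norm_pos_iff.2 hv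
  have au := planeWeight_nonneg u
  have av := planeWeight_nonneg v
  by_cases hvM : ‖v‖ ≤ M
  swap
  · have hz : ∀ z, H (v, z) = 0 := fun z => by
      by_contra hne; exact hvM (hsupp _ hne).1
    have hK : coneKernel H y w u v = 0 := by simp [coneKernel, hz]
    rw [hK, abs_zero]
    positivity
  obtain ⟨hw1, hw2⟩ := hw hvM
  have hvi := inv_norm_le_planeWeight hvM
  by_cases hu1 : 1 < ‖u‖
  · have hB : |H (v, y * (‖w - u‖ / ‖u‖)) - H (v, y)| ≤ C * (y * K * ‖u‖⁻¹) := by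
      refine (hlip _ _ _).trans ?_
      gcongr
      have h1 : y * (‖w - u‖ / ‖u‖) - y = y * ((‖w - u‖ - ‖u‖) * ‖u‖⁻¹) := by field_simp
      rw [h1, abs_mul, abs_mul, abs_of_pos hy, abs_of_pos (inv_pos.2 hu0), mul_assoc]
      gcongr
      have := abs_norm_sub_norm_le (w - u) (-u)
      rw [norm_neg] at this
      refine this.trans ?_
      simpa using hw2
    have h1v : 1 ≤ M * (1 + M ^ 2) * planeWeight v := by
      calc 1 = ‖v‖ * ‖v‖⁻¹ := by field_simp
        _ ≤ M * ((1 + M ^ 2) * planeWeight v) := by gcongr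
        _ = _ := by ring
    have hpu := inv_norm_pow_le_planeWeight hu1
    unfold coneKernel
    rw [abs_mul, abs_of_nonneg (by positivity : 0 ≤ (‖u‖ ^ 2)⁻¹),
      Set.indicator_of_mem (show u ∈ {u : Plane | 1 < ‖u‖} from hu1)]
    calc _ ≤ (‖u‖ ^ 2)⁻¹ * (C * (y * K * ‖u‖⁻¹)) := by gcongr
      _ = C * (y * K) * ((‖u‖ ^ 2)⁻¹ * ‖u‖⁻¹) * 1 := by ring
      _ ≤ C * (y * K) * (2 * planeWeight u) * (M * (1 + M ^ 2) * planeWeight v) := by gcongr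
      _ = 0 + C * (y * K) * 2 * (M * (1 + M ^ 2)) * (planeWeight u * planeWeight v) := by ring
      _ ≤ C * (K * (M / y + 1)) * 2 * (1 + M ^ 2) * (planeWeight u * planeWeight v) +
          C * (y * K) * 2 * (M * (1 + M ^ 2)) * (planeWeight u * planeWeight v) := by
        gcongr; positivity
      _ = _ := by ring
  · unfold coneKernel
    rw [Set.indicator_of_notMem (show u ∉ {u : Plane | 1 < ‖u‖} from hu1), sub_zero]
    by_cases hH : H (v, y * (‖w - u‖ / ‖u‖)) = 0
    · rw [hH, mul_zero, abs_zero]; positivity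
    have h2 := (hsupp _ hH).2
    simp only at h2
    rw [abs_of_nonneg (by positivity)] at h2
    have h3 : ‖w - u‖ ≤ M / y * ‖u‖ := by
      rw [div_mul_eq_mul_div, le_div_iff₀ hy]
      calc ‖w - u‖ * y = y * (‖w - u‖ / ‖u‖) * ‖u‖ := by field_simp
        _ ≤ M * ‖u‖ := by gcongr
    have h4 : ‖w‖ ≤ (M / y + 1) * ‖u‖ := by
      calc ‖w‖ = ‖(w - u) + u‖ := by simp
        _ ≤ ‖w - u‖ + ‖u‖ := norm_add_le _ _
        _ ≤ _ := by linarith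
    have h5 : ‖v‖ ≤ K * ((M / y + 1) * ‖u‖) := hw1.trans (by gcongr)
    have h6 : ‖u‖⁻¹ ≤ K * (M / y + 1) * ‖v‖⁻¹ := by
      rw [← div_eq_mul_inv, le_div_iff₀ hv0, inv_mul_le_iff₀ hu0]
      linarith
    have hui := inv_norm_le_planeWeight (not_lt.1 hu1)
    have hbd' := hbd (v, y * (‖w - u‖ / ‖u‖))
    rw [abs_mul, abs_of_nonneg (by positivity : 0 ≤ (‖u‖ ^ 2)⁻¹)]
    calc _ ≤ (‖u‖ ^ 2)⁻¹ * C := by gcongr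
      _ = C * ‖u‖⁻¹ * ‖u‖⁻¹ := by ring
      _ ≤ C * (K * (M / y + 1) * ‖v‖⁻¹) * ((1 + 1 ^ 2) * planeWeight u) := by gcongr
      _ ≤ C * (K * (M / y + 1) * ((1 + M ^ 2) * planeWeight v)) *
          ((1 + 1 ^ 2) * planeWeight u) := by gcongr
      _ = C * (K * (M / y + 1)) * 2 * (1 + M ^ 2) * (planeWeight u * planeWeight v) + 0 := by ring
      _ ≤ C * (K * (M / y + 1)) * 2 * (1 + M ^ 2) * (planeWeight u * planeWeight v) +
          C * (y * K) * 2 * (M * (1 + M ^ 2)) * (planeWeight u * planeWeight v) := by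
        gcongr; positivity
      _ = _ := by ring

lemma exists_bounds {H : Plane × ℝ → ℝ} (h : ContDiff ℝ 1 H) (hc : HasCompactSupport H) :
    ∃ M C, 0 < M ∧ 0 ≤ C ∧ (∀ q, H q ≠ 0 → ‖q.1‖ ≤ M ∧ |q.2| ≤ M) ∧
      (∀ q, |H q| ≤ C) ∧ ∀ v z z', |H (v, z) - H (v, z')| ≤ C * |z - z'| := by
  obtain ⟨M, hM⟩ := hc.isCompact.isBounded.exists_norm_le
  obtain ⟨C, hC⟩ := h.continuous.bounded_above_of_compact_support hc
  obtain ⟨L, hL⟩ := h.lipschitzWith_of_hasCompactSupport hc (by simp)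
  refine ⟨max M 1, max C L, by positivity, le_max_of_le_right L.2, fun q hq => ?_,
    fun q => (hC q).trans (le_max_left _ _), fun v z z' => ?_⟩
  · have := hM q (subset_tsupport _ hq)
    exact ⟨(norm_fst_le q).trans (this.trans (le_max_left _ _)),
      (norm_snd_le q).trans (this.trans (le_max_left _ _))⟩
  · have := hL.dist_le_mul (v, z) (v, z')
    rw [Prod.dist_eq, dist_self, max_eq_right dist_nonneg, Real.dist_eq, Real.dist_eq] at this
    exact this.trans (by gcongr; exact le_max_right _ _)

lemma integrable_coneKernel {H : Plane × ℝ → ℝ} (h : ContDiff ℝ 1 H) (hc : HasCompactSupport H)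
    {y : ℝ} (hy : 0 < y) {w : Plane → Plane} (hw : Measurable w)
    (hK : ∀ M, ∃ K, 0 ≤ K ∧ ∀ v, ‖v‖ ≤ M → ‖v‖ ≤ K * ‖w v‖ ∧ ‖w v‖ ≤ K) :
    Integrable (fun q : Plane × Plane => coneKernel H y (w q.2) q.1 q.2)
      ((volume : Measure Plane).prod volume) := by
  obtain ⟨M, C, hM, hC, hsupp, hbd, hlip⟩ := exists_bounds h hc
  obtain ⟨K, hK0, hK⟩ := hK M
  have hmeas : Measurable H := h.continuous.measurable
  refine Integrable.mono' ((integrable_planeWeight.mul_prod integrable_planeWeight).const_mul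
    (C * (K * (M / y + 1)) * 2 * (1 + M ^ 2) + C * (y * K) * 2 * (M * (1 + M ^ 2)))) ?_ ?_
  · refine Measurable.aestronglyMeasurable ?_
    have hset : MeasurableSet {q : Plane × Plane | 1 < ‖q.1‖} :=
      measurableSet_lt measurable_const measurable_fst.norm
    have h2 : (fun q : Plane × Plane => coneKernel H y (w q.2) q.1 q.2) = fun q =>
        (‖q.1‖ ^ 2)⁻¹ * (H (q.2, y * (‖w q.2 - q.1‖ / ‖q.1‖)) -
          {q : Plane × Plane | 1 < ‖q.1‖}.indicator (fun q => H (q.2, y)) q) := by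
      ext q; simp [coneKernel, Set.indicator]
    rw [h2]
    exact Measurable.mul (by fun_prop)
      (Measurable.sub (by fun_prop) (Measurable.indicator (by fun_prop) hset))
  · have h0 : ∀ᵐ u : Plane, u ≠ 0 := by simp [ae_iff]
    have h1 : ∀ᵐ q : Plane × Plane ∂(volume.prod volume), q.1 ≠ 0 :=
      Measure.quasiMeasurePreserving_fst.ae h0
    have h2 : ∀ᵐ q : Plane × Plane ∂(volume.prod volume), q.2 ≠ 0 :=
      Measure.quasiMeasurePreserving_snd.ae h0
    filter_upwards [h1, h2] with q hq1 hq2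
    exact abs_coneKernel_le hy hM hK0 hC hsupp hbd hlip hq1 hq2 (hK q.2)

lemma integral_norm_plane (f : ℝ → ℝ) :
    ∫ u : Plane, f ‖u‖ = 2 * π * ∫ r in Set.Ioi (0 : ℝ), r * f r := by
  rw [integral_fun_norm_addHaar (volume : Measure Plane) f]
  have h : (volume : Measure Plane).real (ball 0 1) = π := by
    rw [measureReal_def, InnerProductSpace.volume_ball_of_dim_even (k := 1) (by simp)]
    simp [Real.pi_pos.le]
  simp [h, mul_assoc]

lemma integral_shell {c : ℝ} (hc : 0 < c) :
    ∫ r in Set.Ioi (0 : ℝ), r * ((r ^ 2)⁻¹ *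
      ((Set.Ioi 1).indicator (fun _ => (1 : ℝ)) r - (Set.Ioi c).indicator (fun _ => (1 : ℝ)) r)) =
      Real.log c := by
  have hpt : ∀ r ∈ Set.Ioi (0 : ℝ), r * ((r ^ 2)⁻¹ *
      ((Set.Ioi 1).indicator (fun _ => (1 : ℝ)) r - (Set.Ioi c).indicator (fun _ => (1 : ℝ)) r)) =
      (Set.Ioc 1 c).indicator (fun r => r⁻¹) r - (Set.Ioc c 1).indicator (fun r => r⁻¹) r := by
    intro r hr
    have hr : r ≠ 0 := ne_of_gt hr
    have h1 : r * (r ^ 2)⁻¹ = r⁻¹ := by field_simp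
    rw [← mul_assoc, h1]
    simp only [Set.indicator, Set.mem_Ioi, Set.mem_Ioc]
    split_ifs <;> grind
  have hsub : ∀ a b : ℝ, 0 < a → Set.Ioi (0 : ℝ) ∩ Set.Ioc a b = Set.Ioc a b := fun a b ha =>
    Set.inter_eq_right.2 fun r hr => ha.trans hr.1
  have hint : ∀ a b : ℝ, 0 < a → IntegrableOn (fun r : ℝ => r⁻¹) (Set.Ioc a b) := by
    intro a b ha
    refine (ContinuousOn.integrableOn_Icc (f := fun r : ℝ => r⁻¹) (a := a) (b := b) ?_).mono_set
      Set.Ioc_subset_Icc_self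
    exact continuousOn_inv₀.mono fun r hr => ne_of_gt (ha.trans_le hr.1)
  have hind : ∀ a b : ℝ, 0 < a →
      IntegrableOn ((Set.Ioc a b).indicator fun r : ℝ => r⁻¹) (Set.Ioi 0) := fun a b ha =>
    ((hint a b ha).integrable_indicator measurableSet_Ioc).integrableOn
  rw [setIntegral_congr_fun measurableSet_Ioi hpt, integral_sub (hind _ _ one_pos) (hind _ _ hc),
    setIntegral_indicator measurableSet_Ioc, setIntegral_indicator measurableSet_Ioc,
    hsub _ _ one_pos, hsub _ _ hc]
  have := integral_inv_of_pos one_pos hc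
  rw [div_one] at this
  rw [← this]
  rfl

lemma integral_plane_shell {c : ℝ} (hc : 0 < c) :
    ∫ u : Plane, (‖u‖ ^ 2)⁻¹ * ({u : Plane | 1 < ‖u‖}.indicator (fun _ => (1 : ℝ)) u -
      {u : Plane | c < ‖u‖}.indicator (fun _ => (1 : ℝ)) u) = 2 * π * Real.log c := by
  rw [← integral_shell hc, ← integral_norm_plane]
  rfl

lemma exists_similarity {e v : Plane} (he : ‖e‖ = 1) (hv : v ≠ 0) :
    ∃ A : Plane ≃ₗᵢ[ℝ] Plane, ‖v‖ • A e = v := by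
  have hv0 : ‖v‖ ≠ 0 := norm_ne_zero_iff.2 hv
  refine ⟨Submodule.reflection (ℝ ∙ (e - ‖v‖⁻¹ • v))ᗮ, ?_⟩
  rw [Submodule.reflection_sub, smul_smul, mul_inv_cancel₀ hv0, one_smul]
  rw [norm_smul, norm_inv, norm_norm, inv_mul_cancel₀ hv0, he]

lemma integral_similarity (A : Plane ≃ₗᵢ[ℝ] Plane) {c : ℝ} (hc : 0 < c) (F : Plane → ℝ) :
    ∫ u, F u = ∫ u, c ^ 2 * F (c • A u) := by
  have h1 := A.measurePreserving.integral_comp A.toHomeomorph.measurableEmbedding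
    (fun u => c ^ 2 * F (c • u))
  have h2 := Measure.integral_comp_smul (volume : Measure Plane) F c
  rw [h1, integral_const_mul, h2]
  simp [abs_of_pos hc]
  field_simp

lemma integrable_similarity (A : Plane ≃ₗᵢ[ℝ] Plane) {c : ℝ} (hc : 0 < c) {F : Plane → ℝ}
    (hF : Integrable F) : Integrable fun u => c ^ 2 * F (c • A u) := by
  have h2 := (integrable_comp_smul_iff (volume : Measure Plane) F hc.ne').2 hF
  exact ((A.measurePreserving.integrable_comp_emb A.toHomeomorph.measurableEmbedding).2 h2).const_mul _

lemma integral_coneKernel_sub {H : Plane × ℝ → ℝ} {y : ℝ} {e v : Plane} (he : ‖e‖ = 1)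
    (hv : v ≠ 0) (h1 : Integrable fun u => coneKernel H y v u v)
    (h2 : Integrable fun u => coneKernel H y e u v) :
    (∫ u, coneKernel H y v u v) - ∫ u, coneKernel H y e u v =
      -(2 * π) * (Real.log ‖v‖ * H (v, y)) := by
  obtain ⟨A, hA⟩ := exists_similarity he hv
  have hv0 : 0 < ‖v‖ := norm_pos_iff.2 hv
  rw [integral_similarity A hv0, ← integral_sub (integrable_similarity A hv0 h1) h2]
  have key : ∀ u : Plane, ‖v‖ ^ 2 * coneKernel H y v (‖v‖ • A u) v - coneKernel H y e u v =
      H (v, y) * ((‖u‖ ^ 2)⁻¹ * ({u : Plane | 1 < ‖u‖}.indicator (fun _ => (1 : ℝ)) u -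
      {u : Plane | ‖v‖⁻¹ < ‖u‖}.indicator (fun _ => (1 : ℝ)) u)) := by
    intro u
    have n1 : ‖‖v‖ • A u‖ = ‖v‖ * ‖u‖ := by simp [norm_smul]
    have n2 : ‖v - ‖v‖ • A u‖ = ‖v‖ * ‖e - u‖ := by
      conv_lhs => enter [1, 1]; rw [← hA]
      rw [← smul_sub, ← map_sub, norm_smul, A.norm_map, norm_norm]
    have n3 : 1 < ‖v‖ * ‖u‖ ↔ ‖v‖⁻¹ < ‖u‖ := by
      rw [inv_lt_iff_one_lt_mul₀ hv0, mul_comm]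
    have n4 : ‖v‖ * ‖e - u‖ / (‖v‖ * ‖u‖) = ‖e - u‖ / ‖u‖ := mul_div_mul_left _ _ hv0.ne'
    have n5 : ‖v‖ ^ 2 * ((‖v‖ * ‖u‖) ^ 2)⁻¹ = (‖u‖ ^ 2)⁻¹ := by
      rw [mul_pow, mul_inv, ← mul_assoc, mul_inv_cancel₀ (by positivity), one_mul]
    unfold coneKernel
    simp only [Set.indicator, Set.mem_ofPred_eq, n1, n2, n3, n4]
    rw [← mul_assoc, n5]
    split_ifs <;> ring
  simp_rw [key]
  rw [integral_const_mul, integral_plane_shell (inv_pos.2 hv0), Real.log_inv]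
  ring

/-- The regularized logarithm `½ log (‖v‖² + δ²)`. -/
def regLog (δ : ℝ) (v : Plane) : ℝ := Real.log (‖v‖ ^ 2 + δ ^ 2) / 2

lemma contDiff_regLog {δ : ℝ} (hδ : δ ≠ 0) : ContDiff ℝ (⊤ : ℕ∞) (regLog δ) := by
  unfold regLog
  refine ContDiff.div_const (ContDiff.log ?_ fun v => by positivity) _
  exact (contDiff_norm_sq ℝ).add contDiff_const

lemma hasFDerivAt_norm_sq_add (δ : ℝ) (v : Plane) :
    HasFDerivAt (fun v : Plane => ‖v‖ ^ 2 + δ ^ 2) (2 • innerSL ℝ v) v :=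
  (hasStrictFDerivAt_norm_sq v).hasFDerivAt.add_const _

lemma fderiv_regLog {δ : ℝ} (hδ : δ ≠ 0) (v : Plane) (i : Fin 2) :
    fderiv ℝ (regLog δ) v (EuclideanSpace.single i (1 : ℝ)) = v i * (‖v‖ ^ 2 + δ ^ 2)⁻¹ := by
  have h1 := ((hasFDerivAt_norm_sq_add δ v).log (by positivity)).mul_const (2 : ℝ)⁻¹
  have h2 : HasFDerivAt (regLog δ) _ v := h1
  rw [h2.fderiv]
  simp [EuclideanSpace.inner_single_right]
  ring

lemma lap2_regLog {δ : ℝ} (hδ : δ ≠ 0) (v : Plane) :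
    lap2 (regLog δ) v = 2 * δ ^ 2 * ((‖v‖ ^ 2 + δ ^ 2) ^ 2)⁻¹ := by
  unfold lap2
  simp_rw [fderiv_regLog hδ]
  have key : ∀ i : Fin 2, fderiv ℝ (fun v : Plane => v i * (‖v‖ ^ 2 + δ ^ 2)⁻¹) v
      (EuclideanSpace.single i (1 : ℝ)) =
        (‖v‖ ^ 2 + δ ^ 2)⁻¹ - 2 * v i ^ 2 * ((‖v‖ ^ 2 + δ ^ 2) ^ 2)⁻¹ := by
    intro i
    have hne : ‖v‖ ^ 2 + δ ^ 2 ≠ 0 := by positivity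
    have h1 := (hasDerivAt_inv hne).comp_hasFDerivAt v (hasFDerivAt_norm_sq_add δ v)
    have h2 : HasFDerivAt (fun v : Plane => v i) (EuclideanSpace.proj i : Plane →L[ℝ] ℝ) v :=
      (EuclideanSpace.proj i : Plane →L[ℝ] ℝ).hasFDerivAt
    have h3 := h2.mul h1
    have h4 : HasFDerivAt (fun v : Plane => v i * (‖v‖ ^ 2 + δ ^ 2)⁻¹) _ v := h3
    rw [h4.fderiv]
    simp [EuclideanSpace.inner_single_right]
    ring
  simp_rw [key]
  rw [Fin.sum_univ_two]
  have hn : ‖v‖ ^ 2 = v 0 ^ 2 + v 1 ^ 2 := by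
    rw [EuclideanSpace.real_norm_sq_eq, Fin.sum_univ_two]
  have hne : ‖v‖ ^ 2 + δ ^ 2 ≠ 0 := by positivity
  field_simp
  rw [hn]
  ring

lemma integral_mul_lap2_comm {g φ : Plane → ℝ} (hg : ContDiff ℝ (⊤ : ℕ∞) g)
    (hφ : ContDiff ℝ (⊤ : ℕ∞) φ) (hc : HasCompactSupport φ) :
    ∫ v, g v * lap2 φ v = ∫ v, lap2 g v * φ v := by
  have hI : ∀ {a b : Plane → ℝ}, ContDiff ℝ (⊤ : ℕ∞) a → ContDiff ℝ (⊤ : ℕ∞) b →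
      HasCompactSupport b → Integrable fun v => a v * b v := fun ha hb hbc =>
    (ha.continuous.mul hb.continuous).integrable_of_hasCompactSupport hbc.mul_left
  have hdiff : ∀ {ψ : Plane → ℝ}, ContDiff ℝ (⊤ : ℕ∞) ψ → Differentiable ℝ ψ :=
    fun h => h.differentiable (by simp)
  unfold lap2
  simp_rw [Finset.mul_sum, Finset.sum_mul]
  rw [integral_finsetSum _ fun i _ => ?_, integral_finsetSum _ fun i _ => ?_]
  · refine Finset.sum_congr rfl fun i _ => ?_
    set e : Plane := EuclideanSpace.single i (1 : ℝ)
    have hge := contDiff_fderiv_apply hg e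
    have hφe := contDiff_fderiv_apply hφ e
    have hce : HasCompactSupport fun v => fderiv ℝ φ v e := hc.fderiv_apply (𝕜 := ℝ) e
    have h1 := integral_mul_fderiv_eq_neg_fderiv_mul_of_integrable (μ := (volume : Measure Plane))
      (f := g) (g := fun v => fderiv ℝ φ v e) (v := e) (hI hge hφe hce)
      (hI hg (contDiff_fderiv_apply hφe e) (hce.fderiv_apply (𝕜 := ℝ) e))
      (hI hg hφe hce) (fun x _ => hdiff hg x) (fun x _ => hdiff hφe x)
    have h2 := integral_mul_fderiv_eq_neg_fderiv_mul_of_integrable (μ := (volume : Measure Plane))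
      (f := fun v => fderiv ℝ g v e) (g := φ) (v := e)
      (hI (contDiff_fderiv_apply hge e) hφ hc) (hI hge hφe hce)
      (hI hge hφ hc) (fun x _ => hdiff hge x) (fun x _ => hdiff hφ x)
    rw [h1, h2, neg_neg]
  · exact hI (contDiff_fderiv_apply (contDiff_fderiv_apply hg _) _) hφ hc
  · exact hI hg (contDiff_fderiv_apply (contDiff_fderiv_apply hφ _) _)
      ((hc.fderiv_apply (𝕜 := ℝ) _).fderiv_apply (𝕜 := ℝ) _)

lemma integrable_poisson : Integrable fun v : Plane => 2 * ((‖v‖ ^ 2 + 1) ^ 2)⁻¹ := by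
  have h := (integrable_one_add_norm (E := Plane) (μ := volume) (r := 4)
    (by simp; norm_num)).const_mul 8
  refine h.mono' ?_ (Filter.Eventually.of_forall fun v => ?_)
  · refine Continuous.aestronglyMeasurable ?_
    exact continuous_const.mul (Continuous.inv₀ (by fun_prop) fun v => by positivity)
  · rw [Real.norm_of_nonneg (by positivity), Real.rpow_neg (by positivity)]
    have : (1 + ‖v‖) ^ (4 : ℝ) = (1 + ‖v‖) ^ 4 := by norm_cast
    rw [this, ← div_eq_mul_inv, ← div_eq_mul_inv, div_le_div_iff₀ (by positivity) (by positivity)]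
    have h1 : (1 + ‖v‖) ^ 2 ≤ 2 * (‖v‖ ^ 2 + 1) := by nlinarith [sq_nonneg (1 - ‖v‖)]
    have h2 : ((1 + ‖v‖) ^ 2) ^ 2 ≤ (2 * (‖v‖ ^ 2 + 1)) ^ 2 := by gcongr
    nlinarith

lemma integral_poisson : ∫ v : Plane, 2 * ((‖v‖ ^ 2 + 1) ^ 2)⁻¹ = 2 * π := by
  rw [integral_norm_plane fun r => 2 * ((r ^ 2 + 1) ^ 2)⁻¹]
  have h : ∫ r in Set.Ioi (0 : ℝ), r * (2 * ((r ^ 2 + 1) ^ 2)⁻¹) = 0 - (-((0 : ℝ) ^ 2 + 1)⁻¹) := by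
    refine integral_Ioi_of_hasDerivAt_of_nonneg' (g := fun r : ℝ => -(r ^ 2 + 1)⁻¹) ?_ ?_ ?_
    · intro r _
      have hne : r ^ 2 + 1 ≠ 0 := by positivity
      have h1 := ((((hasDerivAt_id r).pow 2).add_const (1 : ℝ)).inv hne).neg
      convert! h1 using 1
      simp
      field_simp
    · intro r hr
      have : (0 : ℝ) < r := hr
      positivity
    · have h1 : Filter.Tendsto (fun r : ℝ => r ^ 2 + 1) Filter.atTop Filter.atTop :=
        Filter.tendsto_atTop_add_const_right _ _ (Filter.tendsto_pow_atTop (by norm_num))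
      simpa using h1.inv_tendsto_atTop.neg
  rw [h]; simp

lemma integral_regLog_mul_lap2 {φ : Plane → ℝ} (hφ : ContDiff ℝ (⊤ : ℕ∞) φ)
    (hc : HasCompactSupport φ) {δ : ℝ} (hδ : 0 < δ) :
    ∫ v, regLog δ v * lap2 φ v = ∫ v : Plane, 2 * ((‖v‖ ^ 2 + 1) ^ 2)⁻¹ * φ (δ • v) := by
  rw [integral_mul_lap2_comm (contDiff_regLog hδ.ne') hφ hc,
    integral_similarity (LinearIsometryEquiv.refl ℝ Plane) hδ]
  refine integral_congr_ae (Filter.Eventually.of_forall fun v => ?_)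
  simp only [lap2_regLog hδ.ne', LinearIsometryEquiv.coe_refl, id, norm_smul,
    Real.norm_of_nonneg hδ.le]
  have : (δ * ‖v‖) ^ 2 + δ ^ 2 = δ ^ 2 * (‖v‖ ^ 2 + 1) := by ring
  rw [this]
  field_simp

lemma abs_regLog_le {M δ : ℝ} {v : Plane} (hv : v ≠ 0) (hM : ‖v‖ ≤ M) (hδ0 : 0 ≤ δ) (hδ : δ ≤ 1) :
    |regLog δ v| ≤ (1 + M ^ 3) * ((1 + M ^ 2) * planeWeight v) := by
  have hv0 : 0 < ‖v‖ := norm_pos_iff.2 hv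
  have h2 : ‖v‖ ^ 2 ≤ M ^ 3 * ‖v‖⁻¹ := by
    rw [← div_eq_mul_inv, le_div_iff₀ hv0]
    calc _ = ‖v‖ ^ 3 := by ring
      _ ≤ _ := by gcongr
  have hM0 : 0 ≤ M := hv0.le.trans hM
  have h3 : |regLog δ v| ≤ (1 + M ^ 3) * ‖v‖⁻¹ := by
    unfold regLog
    rw [abs_le]
    constructor
    · have h4 : Real.log (‖v‖ ^ 2) ≤ Real.log (‖v‖ ^ 2 + δ ^ 2) :=
        Real.log_le_log (by positivity) (by nlinarith)
      rw [Real.log_pow] at h4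
      have h5 := Real.one_sub_inv_le_log_of_pos hv0
      push_cast at h4
      have : 0 ≤ M ^ 3 * ‖v‖⁻¹ := by positivity
      linarith
    · have h4 := Real.log_le_sub_one_of_pos (by positivity : 0 < ‖v‖ ^ 2 + δ ^ 2)
      have h5 : 0 ≤ ‖v‖⁻¹ := by positivity
      nlinarith
  exact h3.trans (by gcongr; exact inv_norm_le_planeWeight hM)

lemma continuous_lap2 {φ : Plane → ℝ} (hφ : ContDiff ℝ (⊤ : ℕ∞) φ) : Continuous (lap2 φ) :=
  continuous_finsetSum _ fun _ _ =>
    (contDiff_fderiv_apply (contDiff_fderiv_apply hφ _) _).continuous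

lemma hasCompactSupport_lap2 {φ : Plane → ℝ} (hc : HasCompactSupport φ) :
    HasCompactSupport (lap2 φ) := by
  have h0 : ∀ e : Plane, HasCompactSupport fun v => fderiv ℝ (fun v => fderiv ℝ φ v e) v e :=
    fun e => (hc.fderiv_apply (𝕜 := ℝ) e).fderiv_apply (𝕜 := ℝ) e
  have h := (h0 (EuclideanSpace.single 0 1)).add (h0 (EuclideanSpace.single 1 1))
  have h2 : lap2 φ = _ + _ := funext fun v => Fin.sum_univ_two _
  rw [h2]
  exact h

/-- The logarithm is a fundamental solution of the Laplacian in the plane. -/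
theorem integral_log_norm_mul_lap2 {φ : Plane → ℝ} (hφ : ContDiff ℝ (⊤ : ℕ∞) φ)
    (hc : HasCompactSupport φ) : ∫ v, Real.log ‖v‖ * lap2 φ v = 2 * π * φ 0 := by
  have hδ : ∀ᶠ δ : ℝ in nhdsWithin 0 (Set.Ioi 0), 0 < δ ∧ δ ≤ 1 := by
    filter_upwards [self_mem_nhdsWithin, Ioc_mem_nhdsGT one_pos] with δ h1 h2 using ⟨h1, h2.2⟩
  have hcl := hasCompactSupport_lap2 hc
  have l1 : Filter.Tendsto (fun δ => ∫ v, regLog δ v * lap2 φ v) (nhdsWithin 0 (Set.Ioi 0))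
      (nhds (∫ v, Real.log ‖v‖ * lap2 φ v)) := by
    obtain ⟨M, hM0, hM⟩ := hcl.isCompact.isBounded.exists_pos_norm_le
    obtain ⟨C, hC⟩ := (continuous_lap2 hφ).bounded_above_of_compact_support hcl
    refine tendsto_integral_filter_of_dominated_convergence
      (fun v => (1 + M ^ 3) * ((1 + M ^ 2) * planeWeight v) * C) ?_ ?_ ?_ ?_
    · filter_upwards [hδ] with δ h
      exact ((contDiff_regLog h.1.ne').continuous.mul (continuous_lap2 hφ)).aestronglyMeasurable
    · filter_upwards [hδ] with δ h
      have h0 : ∀ᵐ u : Plane, u ≠ 0 := by simp [ae_iff]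
      filter_upwards [h0] with v hv
      by_cases hl : lap2 φ v = 0
      · have hC0 : 0 ≤ C := (norm_nonneg _).trans (hC 0)
        have := planeWeight_nonneg v
        rw [hl, mul_zero, norm_zero]
        positivity
      · rw [norm_mul]
        have hvM := hM v (subset_tsupport _ hl)
        have := abs_regLog_le hv hvM h.1.le h.2
        exact mul_le_mul this (hC v) (norm_nonneg _) ((abs_nonneg _).trans this)
    · exact ((integrable_planeWeight.const_mul _).const_mul _).mul_const _
    · have h0 : ∀ᵐ u : Plane, u ≠ 0 := by simp [ae_iff]
      filter_upwards [h0] with v hv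
      refine Filter.Tendsto.mul_const _ ?_
      have hv0 : ‖v‖ ^ 2 + (0 : ℝ) ^ 2 ≠ 0 := by
        have := norm_pos_iff.2 hv
        positivity
      have h1 : ContinuousAt (fun δ : ℝ => Real.log (‖v‖ ^ 2 + δ ^ 2) / 2) 0 :=
        ContinuousAt.div_const (ContinuousAt.log (f := fun δ : ℝ => ‖v‖ ^ 2 + δ ^ 2)
          (by fun_prop) hv0) _
      have h2 := h1.tendsto.mono_left (nhdsWithin_le_nhds (s := Set.Ioi 0))
      have h3 : Real.log (‖v‖ ^ 2 + 0 ^ 2) / 2 = Real.log ‖v‖ := by simp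
      rw [h3] at h2
      exact h2
  have l2 : Filter.Tendsto (fun δ : ℝ => ∫ v : Plane, 2 * ((‖v‖ ^ 2 + 1) ^ 2)⁻¹ * φ (δ • v))
      (nhdsWithin 0 (Set.Ioi 0))
      (nhds (∫ v : Plane, 2 * ((‖v‖ ^ 2 + 1) ^ 2)⁻¹ * φ 0)) := by
    obtain ⟨C, hC⟩ := hφ.continuous.bounded_above_of_compact_support hc
    refine tendsto_integral_filter_of_dominated_convergence
      (fun v => 2 * ((‖v‖ ^ 2 + 1) ^ 2)⁻¹ * C) ?_ ?_ (integrable_poisson.mul_const _) ?_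
    · refine Filter.Eventually.of_forall fun δ => ?_
      exact integrable_poisson.aestronglyMeasurable.mul
        (hφ.continuous.comp (continuous_const_smul δ)).aestronglyMeasurable
    · refine Filter.Eventually.of_forall fun δ => Filter.Eventually.of_forall fun v => ?_
      rw [norm_mul, Real.norm_of_nonneg (by positivity)]
      gcongr
      exact hC _
    · refine Filter.Eventually.of_forall fun v => Filter.Tendsto.const_mul _ ?_
      have h1 : Continuous fun δ : ℝ => φ (δ • v) := hφ.continuous.comp (by fun_prop)
      have h2 := (h1.tendsto 0).mono_left (nhdsWithin_le_nhds (s := Set.Ioi 0))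
      rwa [zero_smul] at h2
  rw [integral_mul_const, integral_poisson] at l2
  refine tendsto_nhds_unique l1 (l2.congr' ?_)
  filter_upwards [hδ] with δ h
  exact (integral_regLog_mul_lap2 hφ hc h.1).symm

lemma integral_coneKernel_right {h : Plane × ℝ → ℝ} (hh : ContDiff ℝ (⊤ : ℕ∞) h)
    (hc : HasCompactSupport h) (y : ℝ) {w : Plane → Plane} (hw : Continuous w) (u : Plane) :
    ∫ v, coneKernel (lapFst h) y (w v) u v =
      (‖u‖ ^ 2)⁻¹ * ∫ v, lapFst h (v, y * (‖w v - u‖ / ‖u‖)) := by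
  have hcont := (contDiff_lapFst hh).continuous
  have hI : ∀ g : Plane → ℝ, Continuous g → Integrable fun v => lapFst h (v, g v) := fun g hg =>
    (hcont.comp (continuous_id.prodMk hg)).integrable_of_hasCompactSupport
      (hasCompactSupport_comp_graph (hasCompactSupport_lapFst hc) g)
  have h0 := integral_lapFst_slice hh hc y
  unfold coneKernel
  rw [integral_const_mul]
  congr 1
  by_cases hu : 1 < ‖u‖
  · simp only [Set.indicator_of_mem (show u ∈ {u : Plane | 1 < ‖u‖} from hu)]
    rw [integral_sub (hI _ (by fun_prop)) (hI _ continuous_const), h0, sub_zero]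
  · simp only [Set.indicator_of_notMem (show u ∉ {u : Plane | 1 < ‖u‖} from hu), sub_zero]

lemma integral_cone_origin {h : Plane × ℝ → ℝ} (hh : ContDiff ℝ (⊤ : ℕ∞) h)
    (hc : HasCompactSupport h) {y : ℝ} (hy : 0 < y) :
    ∫ u : Plane, (‖u‖ ^ 2)⁻¹ * ∫ v, lapFst h (v, y * (‖v - u‖ / ‖u‖)) =
      -(4 * π ^ 2) * h (0, y) := by
  set e : Plane := EuclideanSpace.single 0 1
  have he : ‖e‖ = 1 := by simp [e]
  have hH1 : ContDiff ℝ 1 (lapFst h) := (contDiff_lapFst hh).of_le (by exact_mod_cast le_top)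
  have hHc := hasCompactSupport_lapFst hc
  have I1 := integrable_coneKernel hH1 hHc hy (w := fun v => v) measurable_id fun M =>
    ⟨max M 1, by positivity, fun v hv =>
      ⟨le_mul_of_one_le_left (norm_nonneg v) (le_max_right M 1), hv.trans (le_max_left M 1)⟩⟩
  have I2 := integrable_coneKernel hH1 hHc hy (w := fun _ => e) measurable_const fun M =>
    ⟨max M 1, by positivity, fun v hv => by
      rw [he, mul_one]; exact ⟨hv.trans (le_max_left M 1), le_max_right M 1⟩⟩
  simp_rw [← integral_coneKernel_right hh hc y (w := fun v => v) continuous_id]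
  have hz : ∫ u, ∫ v, coneKernel (lapFst h) y e u v = 0 := by
    simp_rw [integral_coneKernel_right hh hc y (continuous_const (y := e)),
      integral_lapFst_slice hh hc]
    simp
  have s1 : ∫ u, ∫ v, coneKernel (lapFst h) y v u v = ∫ v, ∫ u, coneKernel (lapFst h) y v u v :=
    integral_integral_swap I1
  have s2 : ∫ u, ∫ v, coneKernel (lapFst h) y e u v = ∫ v, ∫ u, coneKernel (lapFst h) y e u v :=
    integral_integral_swap I2
  rw [s2] at hz
  rw [s1, ← sub_zero (∫ v, ∫ u, coneKernel (lapFst h) y v u v), ← hz,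
    ← integral_sub I1.integral_prod_right I2.integral_prod_right]
  have hae : ∀ᵐ v : Plane, ((∫ u, coneKernel (lapFst h) y v u v) -
      ∫ u, coneKernel (lapFst h) y e u v) =
        -(2 * π) * (Real.log ‖v‖ * lap2 (fun v => h (v, y)) v) := by
    have h0 : ∀ᵐ u : Plane, u ≠ 0 := by simp [ae_iff]
    filter_upwards [h0, I1.prod_left_ae, I2.prod_left_ae] with v hv h1 h2
    rw [integral_coneKernel_sub he hv h1 h2, lap2_slice hh]
  rw [integral_congr_ae hae, integral_const_mul, integral_log_norm_mul_lap2
    (φ := fun v => h (v, y)) (hh.comp (contDiff_id.prodMk contDiff_const))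
    (hasCompactSupport_comp_graph hc _)]
  ring

lemma lapFst_translate {h : Plane × ℝ → ℝ} (hh : ContDiff ℝ (⊤ : ℕ∞) h) (x v : Plane) (z : ℝ) :
    lapFst (fun q => h (q.1 + x, q.2)) (v, z) = lapFst h (v + x, z) := by
  have hh' : ContDiff ℝ (⊤ : ℕ∞) fun q : Plane × ℝ => h (q.1 + x, q.2) :=
    hh.comp ((contDiff_fst.add contDiff_const).prodMk contDiff_snd)
  rw [← lap2_slice hh', ← lap2_slice hh]
  unfold lap2
  simp_rw [fun e w => congrArg (fun L : Plane →L[ℝ] ℝ => L e)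
    (fderiv_comp_add_right (f := fun v => h (v, z)) (x := w) (𝕜 := ℝ) x)]
  refine Finset.sum_congr rfl fun i _ => ?_
  rw [fderiv_comp_add_right
    (f := fun v => fderiv ℝ (fun v => h (v, z)) v (EuclideanSpace.single i 1))]

lemma integral_cone {h : Plane × ℝ → ℝ} (hh : ContDiff ℝ (⊤ : ℕ∞) h)
    (hc : HasCompactSupport h) {y : ℝ} (hy : 0 < y) (x : Plane) :
    ∫ u : Plane, (‖u - x‖ ^ 2)⁻¹ * ∫ v, lapFst h (v, y * (‖v - u‖ / ‖u - x‖)) =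
      -(4 * π ^ 2) * h (x, y) := by
  have hh' : ContDiff ℝ (⊤ : ℕ∞) fun q : Plane × ℝ => h (q.1 + x, q.2) :=
    hh.comp ((contDiff_fst.add contDiff_const).prodMk contDiff_snd)
  have hc' : HasCompactSupport fun q : Plane × ℝ => h (q.1 + x, q.2) :=
    hc.comp_homeomorph ((Homeomorph.addRight x).prodCongr (Homeomorph.refl ℝ))
  have := integral_cone_origin hh' hc' hy
  rw [zero_add] at this
  rw [← this, ← integral_add_right_eq_self _ x]
  refine integral_congr_ae (Filter.Eventually.of_forall fun u => ?_)
  simp only [add_sub_cancel_right, lapFst_translate hh]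
  rw [← integral_add_right_eq_self _ x]
  simp only [add_sub_add_right_eq_sub]

instance : IsFiniteMeasure circleMeasure := by
  unfold circleMeasure
  infer_instance

/-- Integration in polar coordinates on the plane. -/
lemma integral_plane_polar {g : Plane → ℝ} (hg : Integrable g) :
    ∫ w, g w = ∫ s in Set.Ioi (0 : ℝ), s * ∫ n, g (s • (n : Plane)) ∂circleMeasure := by
  have hmp := (volume : Measure Plane).measurePreserving_homeomorphUnitSphereProd
  have hemb := (homeomorphUnitSphereProd Plane).measurableEmbedding
  set G : sphere (0 : Plane) 1 × Set.Ioi (0 : ℝ) → ℝ := fun q => g (q.2.1 • (q.1 : Plane))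
  have hpt : ∀ w : ({0}ᶜ : Set Plane), G (homeomorphUnitSphereProd Plane w) = g w := by
    intro w
    have : ‖(w : Plane)‖ ≠ 0 := norm_ne_zero_iff.2 w.2
    simp [G, smul_smul, this]
  have hG : Integrable G (circleMeasure.prod (.volumeIoiPow (Module.finrank ℝ Plane - 1))) := by
    refine (hmp.integrable_comp_emb hemb).1 ?_
    rw [show G ∘ homeomorphUnitSphereProd Plane = g ∘ Subtype.val from funext hpt]
    exact (integrableOn_iff_comap_subtypeVal (measurableSet_singleton _).compl).1 hg.integrableOn
  calc ∫ w, g w = ∫ w : ({0}ᶜ : Set Plane), g w ∂((volume : Measure Plane).comap Subtype.val) := by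
        rw [integral_subtype_comap (measurableSet_singleton _).compl g, restrict_compl_singleton]
    _ = ∫ q, G q ∂(circleMeasure.prod (.volumeIoiPow (Module.finrank ℝ Plane - 1))) := by
        rw [circleMeasure, ← hmp.integral_comp hemb]
        simp_rw [hpt]
    _ = ∫ s : Set.Ioi (0 : ℝ), (∫ n, g (s.1 • (n : Plane)) ∂circleMeasure)
          ∂(.volumeIoiPow (Module.finrank ℝ Plane - 1)) := integral_prod_symm _ hG
    _ = _ := by
        simp only [Measure.volumeIoiPow, ENNReal.ofReal]
        rw [integral_withDensity_eq_integral_smul,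
          integral_subtype_comap measurableSet_Ioi fun s =>
            Real.toNNReal (s ^ (Module.finrank ℝ Plane - 1)) •
              ∫ n, g (s • (n : Plane)) ∂circleMeasure,
          setIntegral_congr_fun measurableSet_Ioi fun s hs => ?_]
        · rw [NNReal.smul_def, Real.coe_toNNReal _ (pow_nonneg hs.out.le _)]
          simp
        · exact (measurable_subtype_coe.pow_const _).real_toNNReal

/-- The function `z ^ (-p) * f (v, z)`. -/
def weighted (p : ℝ) (f : Plane × ℝ → ℝ) (q : Plane × ℝ) : ℝ := q.2 ^ (-p) * f q

lemma contDiff_weighted (p : ℝ) {f : Plane × ℝ → ℝ} (hf : ContDiff ℝ (⊤ : ℕ∞) f)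
    (hfs : tsupport f ⊆ {q : Plane × ℝ | 0 < q.2}) : ContDiff ℝ (⊤ : ℕ∞) (weighted p f) := by
  rw [contDiff_iff_contDiffAt]
  intro q
  by_cases hq : q ∈ tsupport f
  · exact (contDiffAt_snd.rpow_const_of_ne (hfs hq).ne').mul hf.contDiffAt
  · have h0 : weighted p f =ᶠ[nhds q] fun _ => 0 := by
      filter_upwards [notMem_tsupport_iff_eventuallyEq.1 hq] with r hr
      simp [weighted, hr]
    exact contDiffAt_const.congr_of_eventuallyEq h0

lemma hasCompactSupport_weighted (p : ℝ) {f : Plane × ℝ → ℝ} (hfc : HasCompactSupport f) :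
    HasCompactSupport (weighted p f) := hfc.mul_left

lemma hasCompactSupport_cone {ψ : Plane × ℝ → ℝ} (hc : HasCompactSupport ψ) {C : ℝ} (hC : 0 < C)
    (g : Plane → Plane) : HasCompactSupport fun w => ψ (g w, C * ‖w‖) := by
  obtain ⟨M, hM⟩ := hc.isCompact.isBounded.exists_norm_le
  refine HasCompactSupport.intro (isCompact_closedBall (0 : Plane) (M / C)) fun w hw => ?_
  by_contra hne
  refine hw ?_
  have := (norm_snd_le _).trans (hM _ (subset_tsupport _ hne))
  rw [Real.norm_of_nonneg (by positivity)] at this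
  rw [mem_closedBall_zero_iff, le_div_iff₀ hC]
  linarith

lemma continuous_cone {ψ : Plane × ℝ → ℝ} (hψ : Continuous ψ) (S C : ℝ) (u : Plane) :
    Continuous fun w : Plane => ψ (u + S • w, C * ‖w‖) := by fun_prop

lemma fderiv_integral_cone {ψ : Plane × ℝ → ℝ} (hψ : ContDiff ℝ (⊤ : ℕ∞) ψ)
    (hc : HasCompactSupport ψ) (S : ℝ) {C : ℝ} (hC : 0 < C) (u : Plane) (i : Fin 2) :
    fderiv ℝ (fun u : Plane => ∫ w : Plane, ψ (u + S • w, C * ‖w‖)) u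
        (EuclideanSpace.single i (1 : ℝ)) =
      ∫ w : Plane, partialFst i ψ (u + S • w, C * ‖w‖) := by
  set F' : Plane → Plane → (Plane →L[ℝ] ℝ) := fun u w =>
    (fderiv ℝ ψ (u + S • w, C * ‖w‖)).comp (ContinuousLinearMap.inl ℝ Plane ℝ)
  have hd : Continuous (fderiv ℝ ψ) := hψ.continuous_fderiv (by simp)
  have hF'c : ∀ u, Continuous (F' u) := fun u =>
    (hd.comp (by fun_prop)).clm_comp continuous_const
  obtain ⟨B, hB⟩ := hd.bounded_above_of_compact_support (hc.fderiv (𝕜 := ℝ))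
  obtain ⟨M, hM⟩ := hc.isCompact.isBounded.exists_norm_le
  have hzero : ∀ u w, w ∉ closedBall (0 : Plane) (M / C) →
      fderiv ℝ ψ (u + S • w, C * ‖w‖) = 0 := by
    intro u w hw
    by_contra hne
    refine hw ?_
    have := (norm_snd_le _).trans (hM _ (support_fderiv_subset ℝ hne))
    rw [Real.norm_of_nonneg (by positivity)] at this
    rw [mem_closedBall_zero_iff, le_div_iff₀ hC]
    linarith
  have hder : HasFDerivAt (fun u : Plane => ∫ w : Plane, ψ (u + S • w, C * ‖w‖))
      (∫ w, F' u w) u := by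
    refine hasFDerivAt_integral_of_dominated_of_fderiv_le (s := Set.univ)
      (bound := (closedBall (0 : Plane) (M / C)).indicator
        fun _ => B * ‖ContinuousLinearMap.inl ℝ Plane ℝ‖) Filter.univ_mem ?_ ?_ ?_ ?_ ?_ ?_
    · exact Filter.Eventually.of_forall fun u =>
        (continuous_cone hψ.continuous S C u).aestronglyMeasurable
    · exact (continuous_cone hψ.continuous S C u).integrable_of_hasCompactSupport
        (hasCompactSupport_cone hc hC _)
    · exact (hF'c u).aestronglyMeasurable
    · refine Filter.Eventually.of_forall fun w u _ => ?_
      by_cases hw : w ∈ closedBall (0 : Plane) (M / C)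
      · rw [Set.indicator_of_mem hw]
        refine (ContinuousLinearMap.opNorm_comp_le _ _).trans ?_
        gcongr
        exact hB _
      · rw [Set.indicator_of_notMem hw]
        simp [F', hzero u w hw]
    · exact (integrableOn_const measure_closedBall_lt_top.ne).integrable_indicator
        measurableSet_closedBall
    · refine Filter.Eventually.of_forall fun w u _ => ?_
      have h1 : HasFDerivAt (fun u : Plane => (u + S • w, C * ‖w‖))
          (ContinuousLinearMap.inl ℝ Plane ℝ) u :=
        ((hasFDerivAt_id u).add_const (S • w)).prodMk (hasFDerivAt_const (C * ‖w‖) u)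
      exact ((hψ.differentiable (by simp) _).hasFDerivAt).comp u h1
  rw [hder.fderiv, ContinuousLinearMap.integral_apply]
  · simp [F', partialFst]
  · refine (hF'c u).integrable_of_hasCompactSupport ?_
    refine (HasCompactSupport.intro (isCompact_closedBall (0 : Plane) (M / C)) fun w hw => ?_)
    simp [F', hzero u w hw]

lemma lap2_integral_cone {ψ : Plane × ℝ → ℝ} (hψ : ContDiff ℝ (⊤ : ℕ∞) ψ)
    (hc : HasCompactSupport ψ) (S : ℝ) {C : ℝ} (hC : 0 < C) (u : Plane) :
    lap2 (fun u : Plane => ∫ w : Plane, ψ (u + S • w, C * ‖w‖)) u =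
      ∫ w : Plane, lapFst ψ (u + S • w, C * ‖w‖) := by
  unfold lap2 lapFst
  simp_rw [fderiv_integral_cone hψ hc S hC]
  rw [integral_finsetSum]
  · exact Finset.sum_congr rfl fun i _ => fderiv_integral_cone (contDiff_partialFst hψ i)
      (hasCompactSupport_partialFst hc i) S hC u i
  · intro i _
    exact (continuous_cone (contDiff_partialFst (contDiff_partialFst hψ i) i).continuous S C
      u).integrable_of_hasCompactSupport (hasCompactSupport_cone
        (hasCompactSupport_partialFst (hasCompactSupport_partialFst hc i) i) hC _)

lemma coneRadon3_eq (p : ℝ) {f : Plane × ℝ → ℝ} (hf : ContDiff ℝ (⊤ : ℕ∞) f)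
    (hfc : HasCompactSupport f) (hfs : tsupport f ⊆ {q : Plane × ℝ | 0 < q.2})
    {θ : ℝ} (hC : 0 < Real.cos θ) (u : Plane) :
    coneRadon3 p f u θ = Real.sin θ * Real.cos θ ^ p *
      ∫ w : Plane, weighted p f (u + Real.sin θ • w, Real.cos θ * ‖w‖) := by
  have hi : Integrable fun w : Plane => weighted p f (u + Real.sin θ • w, Real.cos θ * ‖w‖) :=
    (continuous_cone (contDiff_weighted p hf hfs).continuous _ _ u).integrable_of_hasCompactSupport
      (hasCompactSupport_cone (hasCompactSupport_weighted p hfc) hC _)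
  rw [integral_plane_polar hi, ← integral_const_mul, coneRadon3]
  refine setIntegral_congr_fun measurableSet_Ioi fun s hs => ?_
  have hs : 0 < s := hs
  rw [← integral_const_mul, ← integral_const_mul, ← integral_const_mul]
  refine integral_congr_ae (Filter.Eventually.of_forall fun n => ?_)
  have hn : ‖s • (n : Plane)‖ = s := by simp [norm_smul, abs_of_pos hs]
  simp only [weighted, hn, smul_smul]
  rw [Real.mul_rpow hC.le hs.le, Real.rpow_neg hC.le, mul_comm s (Real.sin θ),
    mul_comm s (Real.cos θ)]
  have : Real.cos θ ^ p ≠ 0 := (Real.rpow_pos_of_pos hC p).ne'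
  field_simp

lemma integral_cone_change (ψ : Plane × ℝ → ℝ) {S : ℝ} (hS : 0 < S) (C : ℝ) (u : Plane) :
    ∫ w : Plane, ψ (u + S • w, C * ‖w‖) =
      (S ^ 2)⁻¹ * ∫ v : Plane, ψ (v, C / S * ‖v - u‖) := by
  have h1 := integral_add_right_eq_self (μ := (volume : Measure Plane))
    (fun v => ψ (v, C / S * ‖v - u‖)) u
  rw [← h1, integral_similarity (LinearIsometryEquiv.refl ℝ Plane) hS
    fun v => ψ (v + u, C / S * ‖v + u - u‖), integral_const_mul,
    ← mul_assoc, inv_mul_cancel₀ (by positivity), one_mul]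
  refine integral_congr_ae (Filter.Eventually.of_forall fun v => ?_)
  simp only [LinearIsometryEquiv.coe_refl, id, add_sub_cancel_right, norm_smul,
    Real.norm_of_nonneg hS.le]
  rw [add_comm u, ← mul_assoc, div_mul_cancel₀ _ hS.ne']

lemma lap2_const_mul (c : ℝ) (g : Plane → ℝ) (u : Plane) :
    lap2 (fun v => c * g v) u = c * lap2 g u := by
  unfold lap2
  have h : ∀ (g : Plane → ℝ) (v e : Plane),
      fderiv ℝ (fun v => c * g v) v e = c * fderiv ℝ g v e := by
    intro g v e
    change fderiv ℝ (c • g) v e = _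
    rw [fderiv_const_smul_field]
    rfl
  simp_rw [h, Finset.mul_sum]

lemma vertex_integrand_eq (p : ℝ) {f : Plane × ℝ → ℝ} (hf : ContDiff ℝ (⊤ : ℕ∞) f)
    (hfc : HasCompactSupport f) (hfs : tsupport f ⊆ {q : Plane × ℝ | 0 < q.2})
    {x u : Plane} {y : ℝ} (hy : 0 < y) (hu : u ≠ x) :
    (‖u - x‖ ^ 2 + y ^ 2) ^ ((p - 1) / 2) * ‖u - x‖⁻¹ *
        lap2 (fun v => coneRadon3 p f v (Real.arctan (‖u - x‖ / y))) u =
      y ^ p * ((‖u - x‖ ^ 2)⁻¹ *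
        ∫ v, lapFst (weighted p f) (v, y * (‖v - u‖ / ‖u - x‖))) := by
  have hr : 0 < ‖u - x‖ := norm_pos_iff.2 (sub_ne_zero.2 hu)
  set r := ‖u - x‖
  set ρ := √(r ^ 2 + y ^ 2)
  have hρ : 0 < ρ := Real.sqrt_pos.2 (by positivity)
  have hsq : √(1 + (r / y) ^ 2) = ρ / y := by
    rw [← Real.sqrt_sq hy.le, ← Real.sqrt_div (by positivity), Real.sqrt_sq hy.le]
    congr 1; field_simp; ring
  have hcos : Real.cos (Real.arctan (r / y)) = y / ρ := by
    rw [Real.cos_arctan, hsq, one_div_div]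
  have hsin : Real.sin (Real.arctan (r / y)) = r / ρ := by
    rw [Real.sin_arctan, hsq]; field_simp
  have hC : 0 < Real.cos (Real.arctan (r / y)) := by rw [hcos]; positivity
  have hS : 0 < Real.sin (Real.arctan (r / y)) := by rw [hsin]; positivity
  have hp : (r ^ 2 + y ^ 2) ^ ((p - 1) / 2) = ρ ^ p / ρ := by
    rw [← Real.rpow_sub_one hρ.ne',
      show ρ = (r ^ 2 + y ^ 2) ^ (1 / 2 : ℝ) from Real.sqrt_eq_rpow _,
      ← Real.rpow_mul (by positivity)]
    congr 1; ring
  simp_rw [coneRadon3_eq p hf hfc hfs hC]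
  rw [lap2_const_mul, lap2_integral_cone (contDiff_weighted p hf hfs)
    (hasCompactSupport_weighted p hfc) _ hC, integral_cone_change _ hS, hp, hcos, hsin,
    Real.div_rpow hy.le hρ.le]
  have h1 : ∀ v : Plane, y / ρ / (r / ρ) * ‖v - u‖ = y * (‖v - u‖ / r) := fun v => by field_simp
  simp_rw [h1]
  have : ρ ^ p ≠ 0 := (Real.rpow_pos_of_pos hρ p).ne'
  field_simp

/-- three-dimensional filtered back-projection, vertex parametrization:
`f(x,y) = -(1/(4π²)) ∫_{ℝ²} (|u-x|²+y²)^{(p-1)/2} |u-x|⁻¹ (Δ_u R^(p) f)(u, arctan(|u-x|/y)) du`. -/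
theorem coneRadon3_fbp_vertex (p : ℝ) (f : EuclideanSpace ℝ (Fin 2) × ℝ → ℝ)
    (hf : ContDiff ℝ (⊤ : ℕ∞) f) (hfc : HasCompactSupport f)
    (hfs : tsupport f ⊆ {q : EuclideanSpace ℝ (Fin 2) × ℝ | 0 < q.2})
    (x : EuclideanSpace ℝ (Fin 2)) (y : ℝ) (hy : 0 < y) :
    f (x, y) =
      -(1 / (4 * π ^ 2)) *
        ∫ u, (‖u - x‖ ^ 2 + y ^ 2) ^ ((p - 1) / 2) * ‖u - x‖⁻¹ *
          lap2 (fun v => coneRadon3 p f v (Real.arctan (‖u - x‖ / y))) u := by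
  have hae : ∀ᵐ u : Plane, u ≠ x := by simp [ae_iff]
  rw [integral_congr_ae (hae.mono fun u hu => vertex_integrand_eq p hf hfc hfs hy hu),
    integral_const_mul, integral_cone (contDiff_weighted p hf hfs)
      (hasCompactSupport_weighted p hfc) hy x, weighted, Real.rpow_neg hy.le]
  have : y ^ p ≠ 0 := (Real.rpow_pos_of_pos hy p).ne'
  field_simp
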